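/- Let a, b, n ∈ ℤ and set f₁ = X³ + a·X + (3b − n) and f₂ = X³ − 12a·X² + 36a²·X + (27(3b−n)² + 4a³) in ℚ[X]. Assume that f₁ and f₂ are both irreducible over ℚ and that none of Δ₁(n) = −(4a³ + 27(3b−n)²), Δ₂(n) = −243(4a³+27(3b−n)²)(4a³+3(3b−n)²), and Δ₃(n) = 243(4a³ + 3(3b−n)²) is a square in ℚ. Then the splitting field K over ℚ of the product f₁·f₂ satisfies [K : ℚ] = 36, and its Galois group Gal(K/ℚ) is isomorphic to S₃ × S₃. -/

import Mathlib

open Polynomial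

set_option synthInstance.maxSize 1000 in
set_option synthInstance.maxHeartbeats 200000 in
/-- If a group acts on two three-element sets, transitively on the second one, and some element
acts by an even permutation on the first set and by an odd one on the second, then every
permutation of the second set is induced by an element acting trivially on the first set. -/
theorem exists_eq_one_and_eq_of_sign {G : Type*} [Group G] (φ ψ : G →* Equiv.Perm (Fin 3))
    (hψ : ∀ i j, ∃ g, ψ g i = j)
    (h : ∃ g, Equiv.Perm.sign (φ g) = 1 ∧ Equiv.Perm.sign (ψ g) = -1)
    (τ : Equiv.Perm (Fin 3)) : ∃ g, φ g = 1 ∧ ψ g = τ := by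
  have cube : ∀ σ : Equiv.Perm (Fin 3), Equiv.Perm.sign σ = 1 → σ ^ 3 = 1 := by decide
  have conj : ∀ σ τ : Equiv.Perm (Fin 3), Equiv.Perm.sign σ = -1 → Equiv.Perm.sign τ = -1 →
      ∃ i j : Fin 3, ∀ c : Equiv.Perm (Fin 3), c i = j → c * σ * c⁻¹ = τ := by decide
  obtain ⟨g₀, h₀, h₁⟩ := h
  have odd : ∀ τ : Equiv.Perm (Fin 3), Equiv.Perm.sign τ = -1 → ∃ g, φ g = 1 ∧ ψ g = τ := by
    intro τ hτ
    obtain ⟨i, j, hc⟩ := conj (ψ (g₀ ^ 3)) τ (by rw [map_pow, map_pow, h₁]; rfl) hτ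
    obtain ⟨c, hcij⟩ := hψ i j
    refine ⟨c * g₀ ^ 3 * c⁻¹, ?_, ?_⟩
    · simp [cube _ h₀]
    · rw [map_mul, map_mul, map_inv, hc _ hcij]
  obtain hτ | hτ := Int.units_eq_one_or (Equiv.Perm.sign τ)
  · obtain ⟨g, hg, hg'⟩ := odd (Equiv.swap 0 1) (by decide)
    obtain ⟨k, hk, hk'⟩ := odd (Equiv.swap 0 1 * τ) (by rw [map_mul, hτ]; decide)
    exact ⟨g * k, by simp [hg, hk], by simp [hg', hk', ← mul_assoc]⟩
  · exact odd τ hτ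

/-- Two transitive actions of a group on three letters whose sign characters are nontrivial and
distinct are jointly surjective. -/
theorem prod_surjective_of_sign {G : Type*} [Group G] (φ ψ : G →* Equiv.Perm (Fin 3))
    (hφ : ∀ i j, ∃ g, φ g i = j) (hψ : ∀ i j, ∃ g, ψ g i = j)
    (h₁ : ∃ g, Equiv.Perm.sign (φ g) = -1) (h₂ : ∃ g, Equiv.Perm.sign (ψ g) = -1)
    (h₃ : ∃ g, Equiv.Perm.sign (φ g) * Equiv.Perm.sign (ψ g) = -1) :
    Function.Surjective (φ.prod ψ) := by
  obtain ⟨g₁, h₁⟩ := h₁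
  obtain ⟨g₂, h₂⟩ := h₂
  obtain ⟨g₃, h₃⟩ := h₃
  have key : (∃ g, Equiv.Perm.sign (φ g) = 1 ∧ Equiv.Perm.sign (ψ g) = -1) ∧
      ∃ g, Equiv.Perm.sign (ψ g) = 1 ∧ Equiv.Perm.sign (φ g) = -1 := by
    obtain h | h := Int.units_eq_one_or (Equiv.Perm.sign (φ g₃))
    · rw [h, one_mul] at h₃
      refine ⟨⟨g₃, h, h₃⟩, ?_⟩
      obtain h' | h' := Int.units_eq_one_or (Equiv.Perm.sign (ψ g₁))
      · exact ⟨g₁, h', h₁⟩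
      · exact ⟨g₁ * g₃, by simp [h', h₃], by simp [h, h₁]⟩
    · have h₃ : Equiv.Perm.sign (ψ g₃) = 1 := by simpa [h] using h₃
      refine ⟨?_, ⟨g₃, h₃, h⟩⟩
      obtain h' | h' := Int.units_eq_one_or (Equiv.Perm.sign (φ g₂))
      · exact ⟨g₂, h', h₂⟩
      · exact ⟨g₂ * g₃, by simp [h', h], by simp [h₂, h₃]⟩
  rintro ⟨σ, τ⟩
  obtain ⟨g, hg, hg'⟩ := exists_eq_one_and_eq_of_sign φ ψ hψ key.1 τ
  obtain ⟨k, hk, hk'⟩ := exists_eq_one_and_eq_of_sign ψ φ hφ key.2 σ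
  exact ⟨g * k, by simp [hg, hg', hk, hk']⟩

/-- The action of the Galois group on the roots of a monic irreducible cubic with nonzero
discriminant which splits in `K`, together with the square root of the discriminant. -/
theorem Cubic.exists_perm_roots {F K : Type*} [Field F] [Field K] [Algebra F K] [Normal F K]
    (P : Cubic F) (ha : P.a = 1) (hirr : Irreducible P.toPoly)
    (hsplit : (P.toPoly.map (algebraMap F K)).Splits) (hdisc : P.discr ≠ 0) :
    ∃ (φ : (K ≃ₐ[F] K) →* Equiv.Perm (Fin 3)) (d : K),
      (∀ i j, ∃ g, φ g i = j) ∧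
      (∀ g, φ g = 1 → ∀ x, aeval x P.toPoly = 0 → g x = x) ∧
      d ^ 2 = algebraMap F K P.discr ∧
      ∀ g, g d = ((Equiv.Perm.sign (φ g) : ℤ) : K) * d := by
  have ha0 : P.a ≠ 0 := by simp [ha]
  obtain ⟨r, s, t, h3⟩ := (Cubic.splits_iff_roots_eq_three ha0).mp hsplit
  obtain ⟨hrs, hrt, hst⟩ := (Cubic.discr_ne_zero_iff_roots_ne ha0 h3).mp hdisc
  set x : Fin 3 → K := ![r, s, t] with hx
  have hinj : Function.Injective x := by
    intro i j
    fin_cases i <;> fin_cases j <;> simp [hx, hrs, hrt, hst, hrs.symm, hrt.symm, hst.symm]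
  have hroot (y : K) : aeval y P.toPoly = 0 ↔ ∃ i, x i = y := by
    have hm : (Cubic.map (algebraMap F K) P).toPoly ≠ 0 := by
      rw [Cubic.map_toPoly]
      exact Polynomial.map_ne_zero hirr.ne_zero
    rw [aeval_def, ← eval_map, ← Cubic.map_toPoly]
    change IsRoot _ _ ↔ _
    rw [← mem_roots hm, ← Cubic.roots, h3]
    simp [hx, Fin.exists_fin_succ, eq_comm]
  have hex (g : K ≃ₐ[F] K) (i : Fin 3) : ∃ j, x j = g (x i) := by
    rw [← hroot, ← AlgEquiv.coe_toAlgHom, aeval_algHom_apply, (hroot _).mpr ⟨i, rfl⟩, map_zero]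
  choose p hp using hex
  let φ : (K ≃ₐ[F] K) →* Equiv.Perm (Fin 3) :=
    { toFun := fun g ↦
        { toFun := p g
          invFun := p g⁻¹
          left_inv := fun i ↦ hinj (by rw [hp, hp, ← AlgEquiv.mul_apply]; simp)
          right_inv := fun i ↦ hinj (by rw [hp, hp, ← AlgEquiv.mul_apply]; simp) }
      map_one' := Equiv.ext fun i ↦ hinj (by simp [hp])
      map_mul' := fun g h ↦ Equiv.ext fun i ↦ hinj (by simp [hp]) }
  have hφ (g : K ≃ₐ[F] K) (i : Fin 3) : x (φ g i) = g (x i) := hp g i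
  refine ⟨φ, (Matrix.vandermonde x).det, fun i j ↦ ?_, fun g hg y hy ↦ ?_, ?_, fun g ↦ ?_⟩
  · have hi : aeval (x i) P.toPoly = 0 := (hroot _).mpr ⟨i, rfl⟩
    have hj : aeval (x j) P.toPoly = 0 := (hroot _).mpr ⟨j, rfl⟩
    have hmonic : P.toPoly.Monic := Cubic.monic_of_a_eq_one ha
    obtain ⟨g, hg⟩ := minpoly.exists_algEquiv_of_root' (K := F) (x := x j) (y := x i)
      (Algebra.IsAlgebraic.isAlgebraic _)
      (by rw [← minpoly.eq_of_irreducible_of_monic hirr hi hmonic, hj])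
    exact ⟨g, hinj (by rw [hφ, hg])⟩
  · obtain ⟨i, rfl⟩ := (hroot y).mp hy
    rw [← hφ, hg, Equiv.Perm.one_apply]
  · rw [Cubic.discr_eq_prod_three_roots ha0 h3, ha, Matrix.det_vandermonde]
    simp [hx, Fin.prod_univ_succ, Fin.prod_Ioi_succ]
    ring
  · rw [← Matrix.det_permute, AlgEquiv.map_det]
    congr 1
    ext i j
    simp [Matrix.vandermonde_apply, hφ]

/-- If a square root of `c` in a Galois extension is fixed by the Galois group, then `c` is a
square in the base field. -/
theorem isSquare_of_sq_eq_algebraMap_of_fixed {F K : Type*} [Field F] [Field K] [Algebra F K]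
    [IsGalois F K] {d : K} {c : F} (hd : d ^ 2 = algebraMap F K c)
    (hfix : ∀ g : K ≃ₐ[F] K, g d = d) : IsSquare c := by
  obtain ⟨e, rfl⟩ := (InfiniteGalois.mem_range_algebraMap_iff_fixed d).mpr hfix
  refine ⟨e, (algebraMap F K).injective ?_⟩
  rw [← hd, map_mul, sq]

/-- If two monic irreducible cubics have nonsquare discriminants whose product is not a square
either, then the splitting field of their product has degree 36 and Galois group `S₃ × S₃`. -/
theorem Cubic.finrank_eq_and_gal_mul_mulEquiv {F : Type*} [Field F] [CharZero F] (P Q : Cubic F)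
    (hP : P.a = 1) (hQ : Q.a = 1) (hPirr : Irreducible P.toPoly) (hQirr : Irreducible Q.toPoly)
    (hPd : ¬ IsSquare P.discr) (hQd : ¬ IsSquare Q.discr) (hPQ : ¬ IsSquare (P.discr * Q.discr)) :
    Module.finrank F (P.toPoly * Q.toPoly).SplittingField = 36 ∧
      Nonempty ((P.toPoly * Q.toPoly).Gal ≃* Equiv.Perm (Fin 3) × Equiv.Perm (Fin 3)) := by
  set p := P.toPoly
  set q := Q.toPoly
  set K := (p * q).SplittingField
  have hpq : p * q ≠ 0 := mul_ne_zero hPirr.ne_zero hQirr.ne_zero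
  have hsplit : ((p * q).map (algebraMap F K)).Splits := SplittingField.splits _
  have hmap : (p * q).map (algebraMap F K) ≠ 0 := Polynomial.map_ne_zero hpq
  have : Normal F K := Normal.of_isSplittingField (p * q)
  have : IsGalois F K := ⟨⟩
  obtain ⟨φ, d, hφ, hφ1, hd, hφd⟩ := P.exists_perm_roots (K := K) hP hPirr
    (hsplit.of_dvd hmap (Polynomial.map_dvd _ (dvd_mul_right _ _))) (by rintro h; simp [h] at hPd)
  obtain ⟨ψ, e, hψ, hψ1, he, hψe⟩ := Q.exists_perm_roots (K := K) hQ hQirr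
    (hsplit.of_dvd hmap (Polynomial.map_dvd _ (dvd_mul_left _ _))) (by rintro h; simp [h] at hQd)
  have hinj : Function.Injective (φ.prod ψ) := by
    rw [injective_iff_map_eq_one]
    intro g hg
    rw [MonoidHom.prod_apply, Prod.mk_eq_one] at hg
    refine Gal.ext (p * q) fun x hx ↦ ?_
    rw [mem_rootSet, map_mul, mul_eq_zero] at hx
    exact hx.2.elim (hφ1 g hg.1 x) (hψ1 g hg.2 x)
  have hsurj : Function.Surjective (φ.prod ψ) := by
    refine prod_surjective_of_sign φ ψ hφ hψ ?_ ?_ ?_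
    · by_contra! h
      refine hPd (isSquare_of_sq_eq_algebraMap_of_fixed hd fun g ↦ ?_)
      simp [hφd, (Int.units_eq_one_or _).resolve_right (h g)]
    · by_contra! h
      refine hQd (isSquare_of_sq_eq_algebraMap_of_fixed he fun g ↦ ?_)
      simp [hψe, (Int.units_eq_one_or _).resolve_right (h g)]
    · by_contra! h
      refine hPQ (isSquare_of_sq_eq_algebraMap_of_fixed (d := d * e)
        (by rw [mul_pow, hd, he, map_mul]) fun g ↦ ?_)
      rw [map_mul, hφd, hψe, mul_mul_mul_comm, ← Int.cast_mul, ← Units.val_mul,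
        (Int.units_eq_one_or _).resolve_right (h g)]
      simp
  let E : (K ≃ₐ[F] K) ≃* Equiv.Perm (Fin 3) × Equiv.Perm (Fin 3) :=
    MulEquiv.ofBijective (φ.prod ψ) ⟨hinj, hsurj⟩
  refine ⟨?_, ⟨E⟩⟩
  rw [← IsGalois.card_aut_eq_finrank, Nat.card_congr E.toEquiv]
  simp [Nat.card_eq_fintype_card, Fintype.card_perm, Nat.factorial]

/-- Let `a b n ∈ ℤ` and let `f₁ = X³ + aX + (3b − n)` and
`f₂ = X³ − 12aX² + 36a²X + (27(3b−n)² + 4a³)` in `ℚ[X]`. If `f₁` and `f₂` are irreducible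
over `ℚ` and none of `Δ₁(n)`, `Δ₂(n)`, `Δ₃(n)` is a square in `ℚ`, then the splitting
field `K` of `f₁·f₂` has degree 36 over `ℚ` and `Gal(K/ℚ) ≅ S₃ × S₃`. -/
theorem splitting_field_S3xS3 (a b n : ℤ)
    (f₁ f₂ : ℚ[X])
    (hf₁ : f₁ = X ^ 3 + C (a : ℚ) * X + C (3 * (b : ℚ) - (n : ℚ)))
    (hf₂ : f₂ = X ^ 3 - C (12 * (a : ℚ)) * X ^ 2 + C (36 * (a : ℚ) ^ 2) * X
      + C (27 * (3 * (b : ℚ) - (n : ℚ)) ^ 2 + 4 * (a : ℚ) ^ 3))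
    (hirr₁ : Irreducible f₁) (hirr₂ : Irreducible f₂)
    (hΔ₁ : ¬ IsSquare ((-(4 * a ^ 3 + 27 * (3 * b - n) ^ 2) : ℤ) : ℚ))
    (hΔ₂ : ¬ IsSquare
      ((-243 * (4 * a ^ 3 + 27 * (3 * b - n) ^ 2) * (4 * a ^ 3 + 3 * (3 * b - n) ^ 2) : ℤ) : ℚ))
    (hΔ₃ : ¬ IsSquare ((243 * (4 * a ^ 3 + 3 * (3 * b - n) ^ 2) : ℤ) : ℚ)) :
    Module.finrank ℚ (f₁ * f₂).SplittingField = 36 ∧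
      Nonempty ((f₁ * f₂).Gal ≃* Equiv.Perm (Fin 3) × Equiv.Perm (Fin 3)) := by
  let P : Cubic ℚ := ⟨1, 0, a, 3 * b - n⟩
  let Q : Cubic ℚ := ⟨1, -(12 * a), 36 * a ^ 2, 27 * (3 * b - n) ^ 2 + 4 * a ^ 3⟩
  have hP : f₁ = P.toPoly := by simp [hf₁, P, Cubic.toPoly]
  have hQ : f₂ = Q.toPoly := by simp [hf₂, Q, Cubic.toPoly, sub_eq_add_neg]
  have hPd : P.discr = ((-(4 * a ^ 3 + 27 * (3 * b - n) ^ 2) : ℤ) : ℚ) := by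
    simp only [P, Cubic.discr]
    push_cast
    ring
  have hQd : Q.discr = ((-243 * (4 * a ^ 3 + 27 * (3 * b - n) ^ 2) *
      (4 * a ^ 3 + 3 * (3 * b - n) ^ 2) : ℤ) : ℚ) := by
    simp only [Q, Cubic.discr]
    push_cast
    ring
  have hPQ : Q.discr = P.discr * ((243 * (4 * a ^ 3 + 3 * (3 * b - n) ^ 2) : ℤ) : ℚ) := by
    rw [hPd, hQd]
    push_cast
    ring
  rw [← hPd] at hΔ₁
  rw [← hQd] at hΔ₂
  have hP0 : P.discr ≠ 0 := fun h ↦ by simp [h] at hΔ₁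
  have hΔ₁₂ : ¬ IsSquare (P.discr * Q.discr) := by
    rintro ⟨c, hc⟩
    refine hΔ₃ ⟨c / P.discr, ?_⟩
    rw [div_mul_div_comm, ← hc, hPQ]
    field_simp
  subst hP hQ
  exact Cubic.finrank_eq_and_gal_mul_mulEquiv P Q rfl rfl hirr₁ hirr₂ hΔ₁ hΔ₂ hΔ₁₂
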